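/- Fix real numbers a > 0 and u with u ≠ 1. For every real s > 0 the functions I₀ and I₁ are differentiable at s and I₁'(s) = (1/(1 - u))·( s·I₀'(s) + (1/4)·I₀(s) ) + 1/( 2√a·(1 - u)·√((u + 1)² + s) ). -/

import Mathlib

open Real

/-- `I_ν(s) = (1/√(2a)) ∫₋₁¹ (t+u)ᵛ/(√(t+1)√((t+u)²+s)) dt`. -/
noncomputable def Inu (a u : ℝ) (ν : ℕ) (s : ℝ) : ℝ :=
  (1 / Real.sqrt (2 * a)) *
    ∫ t in (-1 : ℝ)..1, (t + u) ^ ν / (Real.sqrt (t + 1) * Real.sqrt ((t + u) ^ 2 + s))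

open MeasureTheory Set

theorem intervalIntegrable_inv_sqrt_add_one :
    IntervalIntegrable (fun t : ℝ => (√(t + 1))⁻¹) volume (-1) 1 := by
  have h := (intervalIntegral.intervalIntegrable_rpow' (a := 0) (b := 2)
    (r := -(1 / 2)) (by norm_num)).comp_add_right 1
  norm_num at h
  refine h.congr fun t ht => ?_
  rw [uIoc_of_le (by norm_num)] at ht
  have : 0 ≤ t + 1 := by linarith [ht.1]
  rw [Real.sqrt_eq_rpow, ← Real.rpow_neg this]

theorem intervalIntegrable_div_sqrt_add_one {f : ℝ → ℝ} (hf : Continuous f) :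
    IntervalIntegrable (fun t => f t / √(t + 1)) volume (-1) 1 := by
  simpa only [div_eq_mul_inv] using
    intervalIntegrable_inv_sqrt_add_one.continuousOn_mul hf.continuousOn

theorem continuous_pow_div_sqrt (u : ℝ) (ν : ℕ) {s : ℝ} (hs : 0 < s) :
    Continuous fun t : ℝ => (t + u) ^ ν / √((t + u) ^ 2 + s) :=
  (by fun_prop : Continuous fun t : ℝ => (t + u) ^ ν).div (by fun_prop)
    fun t => (Real.sqrt_pos.2 (by positivity)).ne'

theorem continuous_pow_div_mul_sqrt (u : ℝ) (ν : ℕ) {s : ℝ} (hs : 0 < s) :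
    Continuous fun t : ℝ => (t + u) ^ ν / (((t + u) ^ 2 + s) * √((t + u) ^ 2 + s)) :=
  (by fun_prop : Continuous fun t : ℝ => (t + u) ^ ν).div (by fun_prop)
    fun t => by positivity

theorem hasDerivAt_inv_sqrt_add {x s : ℝ} (h : 0 < x + s) :
    HasDerivAt (fun y => (√(x + y))⁻¹) (-(1 / 2) / ((x + s) * √(x + s))) s := by
  have h1 : HasDerivAt (fun y => x + y) 1 s := (hasDerivAt_id s).const_add x
  have h2 := (h1.sqrt h.ne').inv (Real.sqrt_pos.2 h).ne'
  refine h2.congr_deriv ?_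
  have := Real.sqrt_pos.2 h
  rw [Real.sq_sqrt h.le]
  field_simp

theorem hasDerivAt_Inu (a u : ℝ) (ν : ℕ) {s : ℝ} (hs : 0 < s) :
    HasDerivAt (Inu a u ν) ((1 / √(2 * a)) * ∫ t in (-1 : ℝ)..1, -(1 / 2) *
      ((t + u) ^ ν / (((t + u) ^ 2 + s) * √((t + u) ^ 2 + s)) / √(t + 1))) s := by
  refine HasDerivAt.const_mul _ ?_
  have key : ∀ y t : ℝ, (t + u) ^ ν / (√(t + 1) * √((t + u) ^ 2 + y)) =
      (t + u) ^ ν / √((t + u) ^ 2 + y) / √(t + 1) := fun y t => by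
    rw [div_div, mul_comm]
  simp only [key]
  have hpos : ∀ y ∈ Metric.ball s (s / 2), s / 2 < y := fun y hy => by
    rw [Metric.mem_ball, Real.dist_eq, abs_lt] at hy
    linarith [hy.1]
  refine (intervalIntegral.hasDerivAt_integral_of_dominated_loc_of_deriv_le (μ := volume)
    (F := fun y t => (t + u) ^ ν / √((t + u) ^ 2 + y) / √(t + 1))
    (F' := fun y t => -(1 / 2) *
      ((t + u) ^ ν / (((t + u) ^ 2 + y) * √((t + u) ^ 2 + y)) / √(t + 1)))
    (bound := fun t => |t + u| ^ ν / (s / 2 * √(s / 2)) / √(t + 1))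
    (Metric.ball_mem_nhds s (half_pos hs)) ?_ ?_ ?_ ?_ ?_ ?_).2
  · filter_upwards [lt_mem_nhds hs] with y hy
    have h := intervalIntegrable_div_sqrt_add_one (continuous_pow_div_sqrt u ν hy)
    rw [intervalIntegrable_iff] at h
    exact h.aestronglyMeasurable
  · exact intervalIntegrable_div_sqrt_add_one (continuous_pow_div_sqrt u ν hs)
  · have h := (intervalIntegrable_div_sqrt_add_one
      (continuous_pow_div_mul_sqrt u ν hs)).const_mul (-(1 / 2))
    rw [intervalIntegrable_iff] at h
    exact h.aestronglyMeasurable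
  · refine Filter.Eventually.of_forall fun t _ y hy => ?_
    have hy' := hpos y hy
    have hy0 : 0 < y := by linarith
    have hle : s / 2 ≤ (t + u) ^ 2 + y := by nlinarith [sq_nonneg (t + u)]
    rw [norm_mul, norm_div, norm_div, norm_pow, Real.norm_eq_abs (t + u),
      Real.norm_of_nonneg (Real.sqrt_nonneg (t + 1)),
      Real.norm_of_nonneg (by positivity : 0 ≤ ((t + u) ^ 2 + y) * √((t + u) ^ 2 + y))]
    have hhalf : ‖(-(1 / 2) : ℝ)‖ ≤ 1 := by norm_num
    refine (mul_le_of_le_one_left (by positivity) hhalf).trans ?_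
    gcongr
  · exact intervalIntegrable_div_sqrt_add_one
      ((by fun_prop : Continuous fun t : ℝ => |t + u| ^ ν).div_const _)
  · refine Filter.Eventually.of_forall fun t _ y hy => ?_
    have hy0 : 0 < y := by linarith [hpos y hy]
    have h := ((hasDerivAt_inv_sqrt_add (by positivity : 0 < (t + u) ^ 2 + y)).const_mul
      ((t + u) ^ ν)).div_const √(t + 1)
    refine h.congr_deriv ?_
    ring

theorem hasDerivAt_sqrt_div_sqrt (u : ℝ) {s t : ℝ} (hs : 0 < s) (ht : 0 < t + 1) :
    HasDerivAt (fun t => √(t + 1) / √((t + u) ^ 2 + s))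
      ((-(1 / 2) * ((t + u) ^ 0 / √((t + u) ^ 2 + s)) +
        s * ((t + u) ^ 0 / (((t + u) ^ 2 + s) * √((t + u) ^ 2 + s))) -
        (1 - u) * ((t + u) ^ 1 / (((t + u) ^ 2 + s) * √((t + u) ^ 2 + s)))) / √(t + 1)) t := by
  have hR : 0 < (t + u) ^ 2 + s := by positivity
  have h1 := ((hasDerivAt_id t).add_const 1).sqrt ht.ne'
  have h2 := ((((hasDerivAt_id t).add_const u).pow 2).add_const s).sqrt hR.ne'
  refine (h1.div h2 (Real.sqrt_pos.2 hR).ne').congr_deriv ?_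
  have hx := Real.sqrt_pos.2 ht
  have hr := Real.sqrt_pos.2 hR
  have hx2 := Real.sq_sqrt ht.le
  have hr2 := Real.sq_sqrt hR.le
  simp only [id, Pi.pow_apply] at *
  rw [hr2]
  field_simp
  rw [hx2, hr2]
  ring

theorem integral_deriv_sqrt_div_sqrt (u : ℝ) {s : ℝ} (hs : 0 < s) :
    -(1 / 2) * (∫ t in (-1 : ℝ)..1, (t + u) ^ 0 / √((t + u) ^ 2 + s) / √(t + 1)) +
      s * (∫ t in (-1 : ℝ)..1,
        (t + u) ^ 0 / (((t + u) ^ 2 + s) * √((t + u) ^ 2 + s)) / √(t + 1)) -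
      (1 - u) * (∫ t in (-1 : ℝ)..1,
        (t + u) ^ 1 / (((t + u) ^ 2 + s) * √((t + u) ^ 2 + s)) / √(t + 1)) =
      √2 / √((u + 1) ^ 2 + s) := by
  have i0 := (intervalIntegrable_div_sqrt_add_one
    (continuous_pow_div_sqrt u 0 hs)).const_mul (-(1 / 2))
  have i1 := (intervalIntegrable_div_sqrt_add_one
    (continuous_pow_div_mul_sqrt u 0 hs)).const_mul s
  have i2 := (intervalIntegrable_div_sqrt_add_one
    (continuous_pow_div_mul_sqrt u 1 hs)).const_mul (1 - u)
  have hcont : Continuous fun t : ℝ => √(t + 1) / √((t + u) ^ 2 + s) :=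
    (by fun_prop : Continuous fun t : ℝ => √(t + 1)).div (by fun_prop)
      fun t => (Real.sqrt_pos.2 (by positivity)).ne'
  have ftc := intervalIntegral.integral_eq_sub_of_hasDerivAt_of_le (by norm_num)
    hcont.continuousOn
    (fun t ht => (hasDerivAt_sqrt_div_sqrt u hs (by linarith [ht.1])).congr_deriv
      (by ring)) ((i0.add i1).sub i2)
  rw [intervalIntegral.integral_sub (i0.add i1) i2, intervalIntegral.integral_add i0 i1] at ftc
  simp only [intervalIntegral.integral_const_mul] at ftc
  rw [ftc]
  norm_num [add_comm]

/-- for `a > 0`, `u ≠ 1`, `s > 0`, `I₀` and `I₁` are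
differentiable at `s` and
`I₁'(s) = (1/(1-u))(s I₀'(s) + (1/4) I₀(s)) + 1/(2√a (1-u) √((u+1)²+s))`. -/
theorem stmt17 (a u : ℝ) (ha : 0 < a) (hu : u ≠ 1) (s : ℝ) (hs : 0 < s) :
    DifferentiableAt ℝ (Inu a u 0) s ∧ DifferentiableAt ℝ (Inu a u 1) s ∧
    deriv (Inu a u 1) s =
      (1 / (1 - u)) * (s * deriv (Inu a u 0) s + (1 / 4) * Inu a u 0 s) +
        1 / (2 * Real.sqrt a * (1 - u) * Real.sqrt ((u + 1) ^ 2 + s)) := by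
  have d0 := hasDerivAt_Inu a u 0 hs
  have d1 := hasDerivAt_Inu a u 1 hs
  refine ⟨d0.differentiableAt, d1.differentiableAt, ?_⟩
  have key := integral_deriv_sqrt_div_sqrt u hs
  have h0 : Inu a u 0 s = 1 / √(2 * a) *
      ∫ t in (-1 : ℝ)..1, (t + u) ^ 0 / √((t + u) ^ 2 + s) / √(t + 1) := by
    simp only [Inu, div_div, mul_comm √(_ + 1)]
  rw [d0.deriv, d1.deriv, h0]
  simp only [intervalIntegral.integral_const_mul]
  generalize (∫ t in (-1 : ℝ)..1, (t + u) ^ 0 / √((t + u) ^ 2 + s) / √(t + 1)) = A at *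
  generalize (∫ t in (-1 : ℝ)..1,
    (t + u) ^ 0 / (((t + u) ^ 2 + s) * √((t + u) ^ 2 + s)) / √(t + 1)) = B at *
  generalize (∫ t in (-1 : ℝ)..1,
    (t + u) ^ 1 / (((t + u) ^ 2 + s) * √((t + u) ^ 2 + s)) / √(t + 1)) = C at *
  have hu' : 1 - u ≠ 0 := sub_ne_zero.2 hu.symm
  have hR : 0 < √((u + 1) ^ 2 + s) := by positivity
  have hA : 0 < √a := Real.sqrt_pos.2 ha
  have h2 : 0 < √(2 : ℝ) := by positivity
  rw [Real.sqrt_mul (by norm_num)]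
  generalize √((u + 1) ^ 2 + s) = r at *
  field_simp at key ⊢
  linarith
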